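/- There exist a continuously differentiable path X : [0,1] → ℝ and a continuously differentiable non-decreasing surjection Ψ : [0,1] → [0,1] such that the time-augmented paths X̃(t) = (X(t), t) and Ỹ(t) = (X(Ψ(t)), t) have different signatures; specifically, their second-order signature coefficients with multi-index (1,2) differ: S_{(1,2)}(X̃) ≠ S_{(1,2)}(Ỹ). In other words, passing to the time-augmented function avoids the invariance of the signature by time reparameterization. -/

import Mathlib

open MeasureTheory Set

/-- The signature coefficient of a path `W : ℝ → (Fin q → ℝ)` on `[0,1]` associated with the
multi-index `ι : Fin d → Fin q`: the iterated integral
`∫_{0 < t₁ < ⋯ < t_d < 1} ∏_k (W^{(ι k)})'(t_k) dt` over the open simplex. -/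
noncomputable def sigCoeff (a b : ℝ) {q d : ℕ} (W : ℝ → Fin q → ℝ) (ι : Fin d → Fin q) : ℝ :=
  ∫ t in {t : Fin d → ℝ | (∀ k, t k ∈ Ioo a b) ∧ StrictMono t},
    ∏ k, deriv (fun s => W s (ι k)) (t k)


theorem simplex_int (f : ℝ → ℝ) (hf : Continuous f) :
    ∫ t in {t : Fin 2 → ℝ | (∀ k, t k ∈ Ioo (0:ℝ) 1) ∧ StrictMono t}, f (t 0)
      = ∫ x in (0:ℝ)..1, f x * (1 - x) := by
  let S : Set (ℝ × ℝ) := {p | p.1 ∈ Ioo (0:ℝ) 1 ∧ p.2 ∈ Ioo p.1 1}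
  have hS : MeasurableSet S :=
    measurableSet_regionBetween measurable_id measurable_const measurableSet_Ioo
  have h1 : {t : Fin 2 → ℝ | (∀ k, t k ∈ Ioo (0:ℝ) 1) ∧ StrictMono t}
      = (MeasurableEquiv.finTwoArrow (α := ℝ)) ⁻¹' S := by
    ext t
    simp only [S, mem_ofPred_eq, mem_preimage, MeasurableEquiv.finTwoArrow, Fin.forall_fin_two,
      Fin.strictMono_iff_lt_succ, mem_Ioo]
    simp
    constructor
    · rintro ⟨⟨⟨a, b⟩, c, d⟩, e⟩
      exact ⟨⟨a, b⟩, e, d⟩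
    · rintro ⟨⟨a, b⟩, e, d⟩
      exact ⟨⟨⟨a, b⟩, a.trans e, d⟩, e⟩
  have h2 := (volume_preserving_finTwoArrow ℝ).setIntegral_preimage_emb
    (MeasurableEquiv.measurableEmbedding _) (fun p : ℝ × ℝ => f p.1) S
  rw [h1]
  refine Eq.trans h2 ?_
  have hint : IntegrableOn (fun p : ℝ × ℝ => f p.1) S volume := by
    have : IntegrableOn (fun p : ℝ × ℝ => f p.1) (Icc (0:ℝ) 1 ×ˢ Icc (0:ℝ) 1) volume :=
      (hf.comp continuous_fst).continuousOn.integrableOn_compact (isCompact_Icc.prod isCompact_Icc)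
    refine this.mono_set ?_
    rintro ⟨a, b⟩ ⟨h, h'⟩
    exact ⟨⟨h.1.le, h.2.le⟩, ⟨(h.1.trans h'.1).le, h'.2.le⟩⟩
  rw [← integral_indicator hS, Measure.volume_eq_prod, integral_prod]
  · rw [intervalIntegral.integral_of_le zero_le_one, ← integral_Ioc_eq_integral_Ioo.symm,
      ← integral_indicator measurableSet_Ioo]
    congr 1
    ext x
    by_cases hx : x ∈ Ioo (0:ℝ) 1
    · rw [indicator_of_mem hx]
      have : (fun y => S.indicator (fun p : ℝ × ℝ => f p.1) (x, y))
          = (Ioo x 1).indicator (fun _ => f x) := by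
        ext y
        by_cases hy : y ∈ Ioo x 1
        · rw [indicator_of_mem hy, indicator_of_mem (show (x, y) ∈ S from ⟨hx, hy⟩)]
        · rw [indicator_of_notMem hy, indicator_of_notMem (fun h : (x, y) ∈ S => hy h.2)]
      rw [this, integral_indicator measurableSet_Ioo, setIntegral_const]
      simp [hx.2.le, mul_comm]
    · rw [indicator_of_notMem hx]
      have : (fun y => S.indicator (fun p : ℝ × ℝ => f p.1) (x, y)) = fun _ => 0 := by
        ext y
        rw [indicator_of_notMem (fun h : (x, y) ∈ S => hx h.1)]
      rw [this, integral_zero]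
  · exact (integrable_indicator_iff hS).2 hint

/-- Time augmentation breaks the invariance of the signature by time reparameterization:
there exist a continuously differentiable path `X : [0,1] → ℝ` and a continuously
differentiable non-decreasing surjection `Ψ : [0,1] → [0,1]` such that the time-augmented
paths `t ↦ (X t, t)` and `t ↦ (X (Ψ t), t)` have different `(1,2)` signature
coefficients. -/
theorem timeAug_breaks_reparam_invariance :
    ∃ (X Ψ : ℝ → ℝ),
      ContDiffOn ℝ 1 X (Icc (0 : ℝ) 1) ∧
      ContDiffOn ℝ 1 Ψ (Icc (0 : ℝ) 1) ∧
      MonotoneOn Ψ (Icc (0 : ℝ) 1) ∧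
      MapsTo Ψ (Icc (0 : ℝ) 1) (Icc (0 : ℝ) 1) ∧
      SurjOn Ψ (Icc (0 : ℝ) 1) (Icc (0 : ℝ) 1) ∧
      sigCoeff 0 1 (fun t => ![X t, t]) ![(0 : Fin 2), 1] ≠
        sigCoeff 0 1 (fun t => ![X (Ψ t), t]) ![(0 : Fin 2), 1] := by
  refine ⟨fun t => t, fun t => t ^ 2, contDiffOn_id, by fun_prop, ?_, ?_, ?_, ?_⟩
  · intro a ha b _ hab
    exact pow_le_pow_left₀ ha.1 hab 2
  · intro a ha
    exact ⟨by positivity, pow_le_one₀ ha.1 ha.2⟩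
  · intro a ha
    exact ⟨√a, ⟨Real.sqrt_nonneg a, Real.sqrt_le_one.2 ha.2⟩, Real.sq_sqrt ha.1⟩
  · have e1 : sigCoeff 0 1 (fun t => ![t, t]) ![(0 : Fin 2), 1] = 1 / 2 := by
      have := simplex_int (fun _ => 1) continuous_const
      simp only [sigCoeff, Fin.prod_univ_two]
      simp only [Matrix.cons_val_zero, Matrix.cons_val_one, deriv_id'', mul_one]
      rw [this]
      simp only [one_mul]
      rw [intervalIntegral.integral_sub (continuous_const.intervalIntegrable _ _)
        (continuous_id'.intervalIntegrable _ _), intervalIntegral.integral_const, integral_id]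
      norm_num
    have e2 : sigCoeff 0 1 (fun t => ![t ^ 2, t]) ![(0 : Fin 2), 1] = 1 / 3 := by
      have := simplex_int (fun x => 2 * x) (by fun_prop)
      have hd : ∀ x : ℝ, deriv (fun s : ℝ => s ^ 2) x = 2 * x := by intro x; simp
      simp only [sigCoeff, Fin.prod_univ_two]
      simp only [Matrix.cons_val_zero, Matrix.cons_val_one, deriv_id'', mul_one, hd]
      rw [this]
      have : (fun x : ℝ => 2 * x * (1 - x)) = fun x => 2 * x - 2 * x ^ 2 := by
        ext x; ring
      rw [this, intervalIntegral.integral_sub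
        (Continuous.intervalIntegrable (by fun_prop) _ _)
        (Continuous.intervalIntegrable (by fun_prop) _ _),
        intervalIntegral.integral_const_mul, intervalIntegral.integral_const_mul,
        integral_id, integral_pow]
      norm_num
    rw [e1, e2]
    norm_num
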